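/- Let u₀, u, v, v₀ be integers with u₀ ≤ u ≤ v ≤ v₀, and let A be a set of integers with {u₀, v₀} ∪ [u, v] ⊆ A ⊆ [u₀, v₀]. Let r ≥ 2 be an integer, and let ℓ be a positive integer satisfying ℓ ≥ (r(v₀ − u₀) + 1)/(v − u + 1). Then A is an (r,ℓ)-approximate group. -/

import Mathlib

open Pointwise

/-- The `r`-fold sumset `A + A + ⋯ + A` of a set of integers. -/
def ssum (A : Set ℤ) : ℕ → Set ℤ
  | 0 => {0}
  | n + 1 => ssum A n + A

/-- `A` is an `(r, ℓ)`-approximate group: there is a subset `X` of `ℤ` with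
`|X| ≤ ℓ` and `rA ⊆ X + A`. -/
def IsApproxGroup (r ℓ : ℕ) (A : Set ℤ) : Prop :=
  ∃ X : Set ℤ, X.Finite ∧ X.ncard ≤ ℓ ∧ ssum A r ⊆ X + A

/-- The `r`-fold sumset of a subset of `[a, b]` lies in `[r a, r b]`. -/
theorem ssum_subset_Icc {A : Set ℤ} {a b : ℤ} (hA : A ⊆ Set.Icc a b) (r : ℕ) :
    ssum A r ⊆ Set.Icc (r * a) (r * b) := by
  induction r with
  | zero => simp [ssum]
  | succ n ih =>
    rintro _ ⟨x, hx, y, hy, rfl⟩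
    obtain ⟨hx₁, hx₂⟩ := ih hx
    obtain ⟨hy₁, hy₂⟩ := hA hy
    constructor <;> push_cast <;> linarith

/-- Let `u₀ ≤ u ≤ v ≤ v₀` be integers and let `A` be a set of integers with
`{u₀, v₀} ∪ [u,v] ⊆ A ⊆ [u₀,v₀]`.  Let `r ≥ 2` and let `ℓ ≥ 1` satisfy
`ℓ ≥ (r(v₀ − u₀) + 1)/(v − u + 1)`.  Then `A` is an `(r,ℓ)`-approximate group. -/
theorem approx_group_of_interval_structure
    (u₀ u v v₀ : ℤ) (h1 : u₀ ≤ u) (h2 : u ≤ v) (h3 : v ≤ v₀)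
    (A : Set ℤ)
    (hA1 : ({u₀, v₀} : Set ℤ) ∪ Set.Icc u v ⊆ A)
    (hA2 : A ⊆ Set.Icc u₀ v₀)
    (r : ℕ) (hr : 2 ≤ r)
    (ℓ : ℕ) (hℓ : 0 < ℓ)
    (hineq : ((r * (v₀ - u₀) + 1 : ℤ) : ℚ) / ((v - u + 1 : ℤ) : ℚ) ≤ (ℓ : ℚ)) :
    IsApproxGroup r ℓ A := by
  have hm : 0 < v - u + 1 := by omega
  have hlen : r * (v₀ - u₀) + 1 ≤ ℓ * (v - u + 1) := by
    rw [div_le_iff₀ (by exact_mod_cast hm)] at hineq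
    exact_mod_cast hineq
  let f : ℕ → ℤ := fun i => r * u₀ + i * (v - u + 1) - u
  refine ⟨(Finset.range ℓ).image f, Finset.finite_toSet _, ?_, fun n hn => ?_⟩
  · rw [Set.ncard_coe_finset]
    exact Finset.card_image_le.trans_eq (Finset.card_range ℓ)
  · obtain ⟨hn₁, hn₂⟩ := ssum_subset_Icc hA2 r hn
    have hdiv := Int.emod_add_mul_ediv (n - r * u₀) (v - u + 1)
    have hmod₀ := Int.emod_nonneg (n - r * u₀) hm.ne'
    have hmod₁ := Int.emod_lt_of_pos (n - r * u₀) hm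
    obtain ⟨q, hq⟩ := Int.eq_ofNat_of_zero_le
      (Int.ediv_nonneg (sub_nonneg.2 hn₁) hm.le)
    rw [hq] at hdiv
    have hqℓ : (q : ℤ) < ℓ := by
      refine lt_of_mul_lt_mul_right ?_ hm.le
      linarith
    refine Set.mem_add.2 ⟨f q, ?_, u + (n - r * u₀) % (v - u + 1),
      hA1 (Or.inr ⟨by linarith, by linarith⟩), ?_⟩
    · exact Finset.mem_coe.2
        (Finset.mem_image_of_mem f (Finset.mem_range.2 (by exact_mod_cast hqℓ)))
    · simp only [f]
      linarith
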